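/- Satisfiability threshold for random 2-CNF: Let δ ≥ 0 be a fixed real constant and, for each n, let F be drawn from 𝓕₂(n,⌊δn⌋). If δ < 1 then lim_{n→∞} Pr[F is satisfiable] = 1, and if δ > 1 then lim_{n→∞} Pr[F is satisfiable] = 0. -/

import Mathlib

open Finset Filter

/-- A 2-clause over variables `x_0, …, x_{n-1}`: an (ordered) pair of literals on two
distinct variables, the first literal having the smaller variable index.  A literal is a
pair (variable, polarity).  There are `4 * (n choose 2)` such clauses. -/
abbrev Clause (n : ℕ) := {p : (Fin n × Bool) × (Fin n × Bool) // p.1.1 < p.2.1}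

/-- Value of a literal under a total assignment. -/
def litVal {n : ℕ} (σ : Fin n → Bool) (ℓ : Fin n × Bool) : Bool :=
  if ℓ.2 then σ ℓ.1 else !(σ ℓ.1)

/-- A total assignment satisfies a 2-clause. -/
def clauseSat {n : ℕ} (σ : Fin n → Bool) (C : Clause n) : Prop :=
  litVal σ C.val.1 = true ∨ litVal σ C.val.2 = true

/-- Probability of the event `P` under the uniform distribution on the finite type `Ω`. -/
noncomputable def pr (Ω : Type*) [Fintype Ω] (P : Ω → Prop) : ℝ :=
  (Nat.card {ω : Ω // P ω} : ℝ) / (Fintype.card Ω : ℝ)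

namespace TwoSat

variable {n : ℕ}

/-- The negation of a literal. -/
def neg (a : Fin n × Bool) : Fin n × Bool := (a.1, !a.2)

@[simp] lemma neg_fst (a : Fin n × Bool) : (neg a).1 = a.1 := rfl

@[simp] lemma neg_neg (a : Fin n × Bool) : neg (neg a) = a := by simp [neg]

lemma neg_ne (a : Fin n × Bool) : neg a ≠ a := by
  intro h
  have := congrArg Prod.snd h
  simp [neg] at this

lemma eq_or_eq_neg {a b : Fin n × Bool} (h : a.1 = b.1) : a = b ∨ a = neg b := by
  obtain ⟨i, s⟩ := a
  obtain ⟨j, t⟩ := b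
  simp only at h
  subst h
  cases s <;> cases t <;> simp [neg]

lemma litVal_neg (σ : Fin n → Bool) (a : Fin n × Bool) : litVal σ (neg a) = !litVal σ a := by
  obtain ⟨i, s⟩ := a
  cases s <;> simp [neg, litVal]

/-- `C` is the clause `a ∨ b`. -/
def IsClause (C : Clause n) (a b : Fin n × Bool) : Prop := C.val = (a, b) ∨ C.val = (b, a)

lemma IsClause.symm {C : Clause n} {a b : Fin n × Bool} (h : IsClause C a b) : IsClause C b a :=
  Or.symm h

lemma exists_isClause {a b : Fin n × Bool} (h : a.1 ≠ b.1) : ∃ C, IsClause C a b := by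
  rcases lt_or_gt_of_ne h with h | h
  · exact ⟨⟨(a, b), h⟩, Or.inl rfl⟩
  · exact ⟨⟨(b, a), h⟩, Or.inr rfl⟩

lemma IsClause.unique {C D : Clause n} {a b : Fin n × Bool} (h : IsClause C a b)
    (h' : IsClause D a b) : C = D := by
  have h1 := C.2
  have h2 := D.2
  apply Subtype.ext
  rcases h with h | h <;> rcases h' with h' | h' <;> rw [h] at h1 ⊢ <;> rw [h'] at h2 ⊢
  · exact absurd h1 h2.asymm
  · exact absurd h1 h2.asymm

lemma IsClause.eq_or {C : Clause n} {a b c d : Fin n × Bool} (h : IsClause C a b)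
    (h' : IsClause C c d) : (a = c ∧ b = d) ∨ (a = d ∧ b = c) := by
  rcases h with h | h <;> rcases h' with h' | h' <;> rw [h] at h' <;>
    simp only [Prod.mk.injEq] at h' <;> tauto

lemma IsClause.sat {C : Clause n} {a b : Fin n × Bool} (h : IsClause C a b) {σ : Fin n → Bool}
    (hσ : clauseSat σ C) : litVal σ a = true ∨ litVal σ b = true := by
  unfold clauseSat at hσ
  rcases h with h | h <;> rw [h] at hσ
  · exact hσ
  · exact hσ.symm

/-- The implication digraph of a 2-CNF: `Imp F u v` if `¬u ∨ v` is a clause of `F`. -/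
def Imp (F : Finset (Clause n)) (u v : Fin n × Bool) : Prop := ∃ C ∈ F, IsClause C (neg u) v

lemma Imp.contrapose {F : Finset (Clause n)} {u v : Fin n × Bool} (h : Imp F u v) :
    Imp F (neg v) (neg u) := by
  obtain ⟨C, hC, h⟩ := h
  exact ⟨C, hC, by simpa using h.symm⟩

lemma Imp.litVal {F : Finset (Clause n)} {u v : Fin n × Bool} (h : Imp F u v) {σ : Fin n → Bool}
    (hσ : ∀ C ∈ F, clauseSat σ C) (hu : litVal σ u = true) : litVal σ v = true := by
  obtain ⟨C, hC, h⟩ := h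
  rcases h.sat (hσ C hC) with h | h
  · simp [litVal_neg, hu] at h
  · exact h

/-- Satisfiability of a 2-CNF. -/
def Sat (F : Finset (Clause n)) : Prop := ∃ σ : Fin n → Bool, ∀ C ∈ F, clauseSat σ C

lemma Sat.mono {F G : Finset (Clause n)} (h : F ⊆ G) (hG : Sat G) : Sat F := by
  obtain ⟨σ, hσ⟩ := hG
  exact ⟨σ, fun C hC => hσ C (h hC)⟩

/-- Reachability in the implication digraph. -/
abbrev Reach (F : Finset (Clause n)) := Relation.ReflTransGen (Imp F)

lemma Reach.contrapose {F : Finset (Clause n)} {u v : Fin n × Bool} (h : Reach F u v) :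
    Reach F (neg v) (neg u) := by
  induction h with
  | refl => exact .refl
  | tail _ h ih => exact .head h.contrapose ih

/-- A 2-CNF without contradictory literals is satisfiable. -/
lemma sat_of_no_contradiction {F : Finset (Clause n)}
    (h : ∀ x, Reach F x (neg x) → Reach F (neg x) x → False) : Sat F := by
  classical
  let good : Set (Set (Fin n × Bool)) :=
    {S | (∀ a ∈ S, neg a ∉ S) ∧ ∀ a ∈ S, ∀ b, Reach F a b → b ∈ S}
  have hne : good.Nonempty := ⟨∅, by simp [good]⟩
  obtain ⟨S, hS⟩ := (Set.toFinite good).exists_maximal hne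
  have key : ∀ x, ¬ Reach F x (neg x) → x ∈ S ∨ neg x ∈ S := by
    intro x hx
    by_contra! hc
    have hg : S ∪ {y | Reach F x y} ∈ good := by
      constructor
      · rintro a (ha | ha) (hb | hb)
        · exact hS.1.1 a ha hb
        · have := Reach.contrapose hb
          rw [neg_neg] at this
          exact hc.2 (hS.1.2 a ha _ this)
        · exact hc.2 (hS.1.2 _ hb _ (Reach.contrapose ha))
        · have := Reach.contrapose hb
          rw [neg_neg] at this
          exact hx (Relation.ReflTransGen.trans ha this)
      · rintro a (ha | ha) b hb
        · exact Or.inl (hS.1.2 a ha b hb)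
        · exact Or.inr (Relation.ReflTransGen.trans ha hb)
    exact hc.1 (hS.2 hg Set.subset_union_left (Or.inr .refl))
  have tot : ∀ x, x ∈ S ∨ neg x ∈ S := by
    intro x
    by_cases hx : Reach F x (neg x)
    · have h2 : ¬ Reach F (neg x) (neg (neg x)) := by
        rw [neg_neg]
        exact h x hx
      have := key _ h2
      rw [neg_neg] at this
      exact this.symm
    · exact key x hx
  let σ : Fin n → Bool := fun i => decide ((i, true) ∈ S)
  have hσ : ∀ a ∈ S, litVal σ a = true := by
    rintro ⟨i, s⟩ ha
    cases s
    · have := hS.1.1 _ ha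
      simpa [litVal, σ, neg] using this
    · simpa [litVal, σ] using ha
  refine ⟨σ, fun C hC => ?_⟩
  rcases tot C.val.1 with h1 | h1
  · exact Or.inl (hσ _ h1)
  · refine Or.inr (hσ _ (hS.1.2 _ h1 _ (.single ⟨C, hC, ?_⟩)))
    rw [neg_neg]
    exact Or.inl rfl

/-- A walk of length `t` from `u` to `v`. -/
def IsWalk (F : Finset (Clause n)) (w : ℕ → Fin n × Bool) (t : ℕ) (u v : Fin n × Bool) : Prop :=
  w 0 = u ∧ w t = v ∧ ∀ i < t, Imp F (w i) (w (i + 1))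

lemma IsWalk.reach {F : Finset (Clause n)} {w : ℕ → Fin n × Bool} {t : ℕ} {u v : Fin n × Bool}
    (h : IsWalk F w t u v) {i j : ℕ} (hij : i ≤ j) (hj : j ≤ t) : Reach F (w i) (w j) := by
  induction j, hij using Nat.le_induction with
  | base => exact .refl
  | succ j hij ih => exact (ih (by omega)).tail (h.2.2 j (by omega))

lemma exists_isWalk {F : Finset (Clause n)} {u v : Fin n × Bool} (h : Reach F u v) :
    ∃ t w, IsWalk F w t u v := by
  induction h with
  | refl => exact ⟨0, fun _ => u, rfl, rfl, by simp⟩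
  | @tail b c _ hbc ih =>
    obtain ⟨t, w, h0, ht, h⟩ := ih
    refine ⟨t + 1, fun i => if i ≤ t then w i else c, by simp [h0], by simp, fun i hi => ?_⟩
    rcases Nat.lt_succ_iff_lt_or_eq.1 hi with hi' | rfl
    · simpa [hi'.le, Nat.succ_le_of_lt hi'] using h i hi'
    · simpa [ht] using hbc

/-- The obstruction to satisfiability used in the first moment bound: a walk `c 0, …, c (k + 1)`
that visits new variables except at `t`, where it is the negation of `c 0`, and at the end. -/
structure Obstruction (F : Finset (Clause n)) (k t : ℕ) (c : ℕ → Fin n × Bool) : Prop where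
  pos : 0 < t
  le : t ≤ k
  turn : c t = neg (c 0)
  inj : ∀ i j, i < j → j ≤ k → i ≠ t → j ≠ t → (c i).1 ≠ (c j).1
  last : ∃ s ≤ k, (c (k + 1)).1 = (c s).1
  step : ∀ i ≤ k, Imp F (c i) (c (i + 1))

lemma exists_obstruction {F : Finset (Clause n)} (hF : ¬ Sat F) :
    ∃ k t c, Obstruction F k t c := by
  classical
  have hx : ∃ x, Reach F x (neg x) ∧ Reach F (neg x) x := by
    by_contra! hc
    exact hF (sat_of_no_contradiction fun x h1 h2 => hc x h1 h2)
  have hex : ∃ t, ∃ w y, IsWalk F w t y (neg y) ∧ Reach F (neg y) y := by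
    obtain ⟨x, h1, h2⟩ := hx
    obtain ⟨t, w, hw⟩ := exists_isWalk h1
    exact ⟨t, w, x, hw, h2⟩
  let t := Nat.find hex
  obtain ⟨w, y, hw, hy⟩ := Nat.find_spec hex
  have hmin : ∀ s < t, ¬ ∃ w y, IsWalk F w s y (neg y) ∧ Reach F (neg y) y :=
    fun s hs => Nat.find_min hex hs
  change IsWalk F w t y (neg y) at hw
  have hwinj : ∀ i j, i < j → j < t → (w i).1 ≠ (w j).1 := by
    intro i j hij hj heq
    rcases eq_or_eq_neg heq with h | h
    · refine hmin (t - (j - i)) (by omega)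
        ⟨fun s => if s ≤ i then w s else w (s + (j - i)), y, ⟨by simp [hw.1], ?_, ?_⟩, hy⟩
      · have : ¬ (t - (j - i) ≤ i) := by omega
        simp only [this, if_false]
        rw [← hw.2.1]
        congr 1
        omega
      · intro s hs
        rcases lt_trichotomy s i with h' | h' | h'
        · simpa [h'.le, Nat.succ_le_of_lt h'] using hw.2.2 s (by omega)
        · subst h'
          have e : s + 1 + (j - s) = j + 1 := by omega
          simpa [h, e] using hw.2.2 j hj
        · have h1 : ¬ s ≤ i := by omega
          have h2 : ¬ s + 1 ≤ i := by omega
          have e : s + 1 + (j - i) = s + (j - i) + 1 := by omega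
          simpa [h1, h2, e] using hw.2.2 (s + (j - i)) (by omega)
    · refine hmin (j - i) (by omega) ⟨fun s => w (i + s), w i, ⟨by simp, ?_, ?_⟩, ?_⟩
      · have e : i + (j - i) = j := by omega
        simp [e, h]
      · intro s hs
        exact hw.2.2 (i + s) (by omega)
      · have e1 := hw.reach (i := j) (j := t) (by omega) le_rfl
        have e2 := hw.reach (i := 0) (j := i) (by omega) (by omega)
        rw [hw.2.1] at e1
        rw [hw.1] at e2
        rw [h, neg_neg, ← h]
        exact e1.trans (hy.trans e2)
  have ht : 0 < t := by
    rcases Nat.eq_zero_or_pos t with h | h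
    · have := hw.2.1
      rw [h, hw.1] at this
      exact absurd this.symm (neg_ne y)
    · exact h
  obtain ⟨r, z, hz⟩ := exists_isWalk hy
  have hr : r ≠ 0 := by
    rintro rfl
    exact neg_ne y (hz.1.symm.trans hz.2.1)
  let c : ℕ → Fin n × Bool := fun s => if s ≤ t then w s else z (s - t)
  have hc0 : c 0 = y := by simp [c, hw.1]
  have hct : c t = neg y := by simp [c, hw.2.1]
  have hrep : ∃ k, t ≤ k ∧ k + 1 ≤ t + r ∧ ∃ s ≤ k, (c (k + 1)).1 = (c s).1 := by
    refine ⟨t + r - 1, by omega, by omega, 0, by omega, ?_⟩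
    have h1 : ¬ (t + r - 1 + 1 ≤ t) := by omega
    have h2 : t + r - 1 + 1 - t = r := by omega
    rw [hc0]
    simp [c, h1, h2, hz.2.1]
  have hk := Nat.find_spec hrep
  have hkmin : ∀ s < Nat.find hrep, _ := fun s hs => Nat.find_min hrep hs
  set k := Nat.find hrep with hkdef
  refine ⟨k, t, c, ht, hk.1, by rw [hct, hc0], ?_, hk.2.2, ?_⟩
  · intro i j hij hj hit hjt heq
    rcases lt_or_ge j t with h | h
    · have := hwinj i j hij h
      simp only [c, h.le, (hij.trans h).le, if_true] at heq
      exact this heq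
    · refine hkmin (j - 1) (by omega) ⟨by omega, by omega, i, by omega, ?_⟩
      rw [Nat.sub_add_cancel (by omega)]
      exact heq.symm
  · intro i hi
    rcases lt_trichotomy i t with h | h | h
    · simpa [c, h.le, Nat.succ_le_of_lt h] using hw.2.2 i h
    · have := hz.2.2 0 (by omega)
      rw [hz.1] at this
      subst h
      rw [hct]
      simpa [c] using this
    · have h1 : ¬ i ≤ t := by omega
      have h2 : ¬ i + 1 ≤ t := by omega
      have e : i + 1 - t = i - t + 1 := by omega
      simpa [c, h1, h2, e] using hz.2.2 (i - t) (by omega)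

/-- The clauses of the walk `c 0, …, c (k + 1)`. -/
noncomputable def walkClauses (k : ℕ) (c : ℕ → Fin n × Bool) : Finset (Clause n) := by
  classical exact univ.filter fun C => ∃ i ≤ k, IsClause C (neg (c i)) (c (i + 1))

lemma mem_walkClauses {k : ℕ} {c : ℕ → Fin n × Bool} {C : Clause n} :
    C ∈ walkClauses k c ↔ ∃ i ≤ k, IsClause C (neg (c i)) (c (i + 1)) := by
  simp [walkClauses]

lemma walkClauses_congr {k : ℕ} {c d : ℕ → Fin n × Bool} (h : ∀ i ≤ k + 1, c i = d i) :
    walkClauses k c = walkClauses k d := by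
  ext C
  simp only [mem_walkClauses]
  refine exists_congr fun i => and_congr_right fun hi => ?_
  rw [h i (by omega), h (i + 1) (by omega)]

lemma Obstruction.subset {F : Finset (Clause n)} {k t : ℕ} {c : ℕ → Fin n × Bool}
    (h : Obstruction F k t c) : walkClauses k c ⊆ F := by
  intro C hC
  obtain ⟨i, hi, hC⟩ := mem_walkClauses.1 hC
  obtain ⟨D, hD, hD'⟩ := h.step i hi
  exact hC.unique hD' ▸ hD

lemma Obstruction.card {F : Finset (Clause n)} {k t : ℕ} {c : ℕ → Fin n × Bool}
    (h : Obstruction F k t c) : k + 1 ≤ (walkClauses k c).card := by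
  classical
  have hst : ∀ i : ℕ, ∃ C, i ≤ k → IsClause C (neg (c i)) (c (i + 1)) := by
    intro i
    by_cases hi : i ≤ k
    · obtain ⟨C, -, hC⟩ := h.step i hi
      exact ⟨C, fun _ => hC⟩
    · obtain ⟨C, -, hC⟩ := h.step 0 (by omega)
      exact ⟨C, fun h' => absurd h' hi⟩
  choose f hf using hst
  have hvar : (c t).1 = (c 0).1 := by rw [h.turn, neg_fst]
  have hpos := h.pos
  have key : ∀ i j, i < j → j ≤ k → f i ≠ f j := by
    intro i j hij hj heq
    have h1 := hf i (by omega)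
    have h2 := hf j hj
    rw [heq] at h1
    rcases h1.eq_or h2 with ⟨h3, -⟩ | ⟨-, h3⟩
    · have h4 : c i = c j := by rw [← neg_neg (c i), h3, neg_neg]
      by_cases hj' : j = t
      · by_cases hi' : i = 0
        · rw [hj', hi', h.turn] at h4
          exact neg_ne _ h4.symm
        · refine h.inj 0 i (by omega) (by omega) (by omega) (by omega) ?_
          rw [h4, hj', hvar]
      · by_cases hi' : i = t
        · refine h.inj 0 j (by omega) (by omega) (by omega) (by omega) ?_
          rw [← h4, hi', hvar]
        · exact h.inj i j hij hj hi' hj' (by rw [h4])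
    · rcases Nat.lt_or_ge (i + 1) j with hlt | hge
      · have h4 : (c (i + 1)).1 = (c j).1 := by rw [h3, neg_fst]
        by_cases hj' : j = t
        · refine h.inj 0 (i + 1) (by omega) (by omega) (by omega) (by omega) ?_
          rw [h4, hj', hvar]
        · by_cases hi' : i + 1 = t
          · refine h.inj 0 j (by omega) (by omega) (by omega) (by omega) ?_
            rw [← h4, hi', hvar]
          · exact h.inj (i + 1) j hlt hj hi' hj' h4
      · have : i + 1 = j := by omega
        rw [this] at h3
        exact neg_ne _ h3.symm
  have hinj : Set.InjOn f (range (k + 1) : Finset ℕ) := by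
    intro i hi j hj heq
    simp only [coe_range, Set.mem_Iio] at hi hj
    by_contra hne
    rcases lt_or_gt_of_ne hne with h' | h'
    · exact key i j h' (by omega) heq
    · exact key j i h' (by omega) heq.symm
  calc k + 1 = (range (k + 1)).card := by simp
    _ ≤ _ := card_le_card_of_injOn f (fun i hi => by
      have : i < k + 1 := by simpa using hi
      exact mem_walkClauses.2 ⟨i, by omega, hf i (by omega)⟩) hinj

/-- The walk visiting the literals `a 0, a 1, …`, with the negation of `a 0` inserted at time `t`,
and ending at time `k + 2` on the variable visited at time `s`. -/
def decode (k : ℕ) (x : (Fin (k + 1) → Fin n × Bool) × Fin (k + 2) × Fin (k + 2) × Bool) (j : ℕ) :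
    Fin n × Bool :=
  let core : ℕ → Fin n × Bool := fun j =>
    if j < x.2.1 then x.1 (Fin.ofNat (k + 1) j)
    else if j = x.2.1 then neg (x.1 0) else x.1 (Fin.ofNat (k + 1) (j - 1))
  if j = k + 2 then (if x.2.2.2 then core x.2.2.1 else neg (core x.2.2.1)) else core j

lemma Obstruction.exists_decode {F : Finset (Clause n)} {k t : ℕ} {c : ℕ → Fin n × Bool}
    (h : Obstruction F (k + 1) t c) : ∃ x, ∀ j ≤ k + 2, c j = decode k x j := by
  obtain ⟨s, hs, hlast⟩ := h.last
  have hpos := h.pos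
  have hle := h.le
  let a : Fin (k + 1) → Fin n × Bool := fun i => if (i : ℕ) < t then c i else c (i + 1)
  let b : Bool := decide (c (k + 2) = c s)
  refine ⟨(a, ⟨t, by omega⟩, ⟨s, by omega⟩, b), ?_⟩
  have hcore : ∀ j ≤ k + 1, (if j < t then a (Fin.ofNat (k + 1) j)
      else if j = t then neg (a 0) else a (Fin.ofNat (k + 1) (j - 1))) = c j := by
    intro j hj
    split_ifs with h1 h2
    · have : j % (k + 1) = j := Nat.mod_eq_of_lt (by omega)
      simp [a, this, h1]
    · simp [a, hpos, h2, h.turn]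
    · have : (j - 1) % (k + 1) = j - 1 := Nat.mod_eq_of_lt (by omega)
      have h3 : ¬ (j - 1 < t) := by omega
      have h4 : j - 1 + 1 = j := by omega
      simp [a, this, h3, h4]
  intro j hj
  simp only [decode]
  rw [hcore s hs]
  by_cases h1 : j = k + 2
  · rw [if_pos h1]
    split_ifs with h2
    · simpa [b, h1] using h2
    · rw [h1]
      have : c (k + 2) ≠ c s := by simpa [b] using h2
      exact (eq_or_eq_neg hlast).resolve_left this
  · rw [if_neg h1]
    exact (hcore j (by omega)).symm

lemma exists_code {F : Finset (Clause n)} (hF : ¬ Sat F) :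
    ∃ k < F.card, ∃ x, k + 2 ≤ (walkClauses (k + 1) (decode (n := n) k x)).card ∧
      walkClauses (k + 1) (decode k x) ⊆ F := by
  obtain ⟨k, t, c, h⟩ := exists_obstruction hF
  obtain ⟨k, rfl⟩ : ∃ l, k = l + 1 := ⟨k - 1, by have := h.pos; have := h.le; omega⟩
  obtain ⟨x, hx⟩ := h.exists_decode
  have h1 := h.card
  have h2 := h.subset
  rw [walkClauses_congr hx] at h1 h2
  have := card_le_card h2
  exact ⟨k, by omega, x, h1, h2⟩

lemma choose_mul_pow_le {m N : ℕ} (h : m ≤ N) (e : ℕ) :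
    m.choose e * N ^ e ≤ N.choose e * m ^ e := by
  have key : m.descFactorial e * N ^ e ≤ N.descFactorial e * m ^ e := by
    induction e with
    | zero => simp
    | succ e ih =>
      rw [Nat.descFactorial_succ, Nat.descFactorial_succ, pow_succ, pow_succ]
      have h1 : (m - e) * N ≤ (N - e) * m := by
        rw [Nat.sub_mul, Nat.sub_mul, Nat.mul_comm N m]
        have := Nat.mul_le_mul_left e h
        omega
      calc (m - e) * m.descFactorial e * (N ^ e * N)
          = ((m - e) * N) * (m.descFactorial e * N ^ e) := by ring
        _ ≤ ((N - e) * m) * (N.descFactorial e * m ^ e) := Nat.mul_le_mul h1 ih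
        _ = _ := by ring
  rw [Nat.descFactorial_eq_factorial_mul_choose, Nat.descFactorial_eq_factorial_mul_choose,
    mul_assoc, mul_assoc] at key
  exact Nat.le_of_mul_le_mul_left key (Nat.factorial_pos e)

section Counting

variable {α : Type*} [Fintype α]

lemma card_superset_le [DecidableEq α] (E : Finset α) (m : ℕ) :
    #{F ∈ powersetCard m univ | E ⊆ F} ≤ (Fintype.card α - #E).choose (m - #E) := by
  rw [← card_compl, ← card_powersetCard]
  refine card_le_card_of_injOn (fun F => F \ E) (fun F hF => ?_) fun F hF G hG h => ?_
  · simp only [coe_filter, mem_powersetCard_univ, Set.mem_ofPred_eq] at hF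
    rw [mem_coe, mem_powersetCard]
    refine ⟨fun x hx => ?_, ?_⟩
    · simpa using (mem_sdiff.1 hx).2
    · rw [card_sdiff_of_subset hF.2, hF.1]
  · simp only [coe_filter, mem_powersetCard_univ, Set.mem_ofPred_eq] at hF hG
    rw [← sdiff_union_of_subset hF.2, ← sdiff_union_of_subset hG.2]
    simp only at h
    rw [h]

lemma card_superset_div_le [DecidableEq α] (E : Finset α) {m : ℕ} (hm : m ≤ Fintype.card α)
    (hα : 0 < Fintype.card α) :
    (#{F ∈ powersetCard m univ | E ⊆ F} : ℝ) ≤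
      (Fintype.card α).choose m * ((m : ℝ) / Fintype.card α) ^ #E := by
  set N := Fintype.card α with hN
  by_cases hE : #E ≤ m
  · have h1 : (#{F ∈ powersetCard m univ | E ⊆ F} : ℝ) ≤ (N - #E).choose (m - #E) := by
      exact_mod_cast card_superset_le E m
    have h2 := Nat.choose_mul (n := N) hE
    have h3 := choose_mul_pow_le hm #E
    have h4 : 0 < N.choose #E := Nat.choose_pos (hE.trans hm)
    refine h1.trans ?_
    rw [div_pow, mul_div_assoc', le_div_iff₀ (by positivity)]
    have h5 : N.choose #E * ((N - #E).choose (m - #E) * N ^ #E) ≤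
        N.choose #E * (N.choose m * m ^ #E) := by
      calc N.choose #E * ((N - #E).choose (m - #E) * N ^ #E)
          = N.choose m * (m.choose #E * N ^ #E) := by rw [← mul_assoc, ← h2, mul_assoc]
        _ ≤ N.choose m * (N.choose #E * m ^ #E) := Nat.mul_le_mul_left _ h3
        _ = _ := by ring
    exact_mod_cast Nat.le_of_mul_le_mul_left h5 h4
  · have : #{F ∈ powersetCard m univ | E ⊆ F} = 0 := by
      rw [card_eq_zero, filter_eq_empty_iff]
      intro F hF hEF
      have := card_le_card hEF
      rw [mem_powersetCard_univ] at hF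
      omega
    rw [this]
    push_cast
    positivity

open Classical in
lemma pr_eq (m : ℕ) (A : Finset α → Prop) :
    pr {s : Finset α // s.card = m} (fun F => A F.val) =
      (#{F ∈ powersetCard m univ | A F} : ℝ) / (Fintype.card α).choose m := by
  unfold pr
  congr 2
  · rw [Nat.card_congr (Equiv.subtypeSubtypeEquivSubtypeInter
      (fun s : Finset α => s.card = m) A), Nat.card_eq_fintype_card, Fintype.card_subtype]
    congr 1
    ext F
    simp
  · rw [Fintype.card_finset_len]

end Counting

lemma card_clause (n : ℕ) : (Fintype.card (Clause n) : ℝ) = 2 * n * (n - 1) := by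
  classical
  let L : Finset ((Fin n × Bool) × (Fin n × Bool)) := {p | p.1.1 < p.2.1}
  let G : Finset ((Fin n × Bool) × (Fin n × Bool)) := {p | p.2.1 < p.1.1}
  let E : Finset ((Fin n × Bool) × (Fin n × Bool)) := {p | p.1.1 = p.2.1}
  have h1 : Fintype.card (Clause n) = #L := Fintype.card_subtype _
  have h2 : #G = #L := by
    refine card_bij (fun p _ => p.swap) ?_ ?_ ?_
    · simp [L, G]
    · intro a _ b _ h
      exact Prod.swap_injective h
    · intro b hb
      exact ⟨b.swap, by simpa [L, G] using hb, by simp⟩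
  have h3 : #E = n * 4 := by
    have : #E = Fintype.card (Fin n × Bool × Bool) := by
      rw [← card_univ]
      refine card_bij (fun p _ => (p.1.1, p.1.2, p.2.2)) ?_ ?_ ?_
      · simp
      · rintro ⟨⟨a, b⟩, c, d⟩ h ⟨⟨a', b'⟩, c', d'⟩ h' heq
        simp only [E, mem_filter, mem_univ, true_and] at h h'
        simp only [Prod.mk.injEq] at heq ⊢
        refine ⟨⟨heq.1, heq.2.1⟩, ?_, heq.2.2⟩
        rw [← h, ← h', heq.1]
      · rintro ⟨a, b, c⟩ -
        exact ⟨((a, b), (a, c)), by simp [E], rfl⟩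
    rw [this]
    simp
  have h4 : #L + #G + #E = (n * 2) * (n * 2) := by
    have hd1 : Disjoint L G := by
      rw [disjoint_left]
      intro p hp hq
      simp only [L, G, mem_filter, mem_univ, true_and] at hp hq
      exact hp.asymm hq
    have hd2 : Disjoint (L ∪ G) E := by
      rw [disjoint_left]
      intro p hp hq
      simp only [L, G, E, mem_union, mem_filter, mem_univ, true_and] at hp hq
      rcases hp with h | h
      · exact h.ne hq
      · exact h.ne' hq
    rw [← card_union_of_disjoint hd1, ← card_union_of_disjoint hd2]
    have : L ∪ G ∪ E = univ := by
      ext p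
      simp only [L, G, E, mem_union, mem_filter, mem_univ, true_and, iff_true]
      rcases lt_trichotomy p.1.1 p.2.1 with h | h | h <;> simp [h]
    rw [this]
    simp
  rw [h2, h3] at h4
  rw [h1]
  have h5 : (#L : ℝ) + #L + n * 4 = (n * 2) * (n * 2) := by exact_mod_cast h4
  linarith

lemma one_sub_sum_le_pr {m : ℕ} (hm : m ≤ Fintype.card (Clause n))
    (hN : 0 < Fintype.card (Clause n)) :
    1 - ∑ k ∈ range m, (2 * n : ℝ) ^ (k + 1) * ((k + 2) ^ 2 * 2) *
        ((m : ℝ) / Fintype.card (Clause n)) ^ (k + 2) ≤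
      pr {s : Finset (Clause n) // s.card = m} (fun F => Sat F.val) := by
  classical
  set N := Fintype.card (Clause n) with hNdef
  have hC : (0 : ℝ) < N.choose m := by exact_mod_cast Nat.choose_pos hm
  have hq : (m : ℝ) / N ≤ 1 := by
    rw [div_le_one (by exact_mod_cast hN)]
    exact_mod_cast hm
  rw [pr_eq, ← hNdef, le_div_iff₀ hC]
  have hsplit : #{F ∈ powersetCard m (univ : Finset (Clause n)) | Sat F} +
      #{F ∈ powersetCard m (univ : Finset (Clause n)) | ¬ Sat F} = N.choose m := by
    rw [card_filter_add_card_filter_not, card_powersetCard, card_univ]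
  have hsub : ({F ∈ powersetCard m (univ : Finset (Clause n)) | ¬ Sat F}) ⊆
      (range m).biUnion fun k => (univ.filter fun x =>
        k + 2 ≤ (walkClauses (k + 1) (decode (n := n) k x)).card).biUnion fun x =>
          {F ∈ powersetCard m univ | walkClauses (k + 1) (decode k x) ⊆ F} := by
    intro F hF
    simp only [mem_filter, mem_powersetCard_univ] at hF
    obtain ⟨k, hk, x, h1, h2⟩ := exists_code hF.2
    simp only [mem_biUnion, mem_range, mem_filter, mem_univ, true_and, mem_powersetCard_univ]
    exact ⟨k, hF.1 ▸ hk, x, h1, hF.1, h2⟩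
  have hbound : (#{F ∈ powersetCard m (univ : Finset (Clause n)) | ¬ Sat F} : ℝ) ≤
      ∑ k ∈ range m, (2 * n : ℝ) ^ (k + 1) * ((k + 2) ^ 2 * 2) *
        (N.choose m * ((m : ℝ) / N) ^ (k + 2)) := by
    calc (#{F ∈ powersetCard m (univ : Finset (Clause n)) | ¬ Sat F} : ℝ)
        ≤ ∑ k ∈ range m, ∑ x ∈ univ.filter fun x =>
            k + 2 ≤ (walkClauses (k + 1) (decode (n := n) k x)).card,
            (#{F ∈ powersetCard m univ | walkClauses (k + 1) (decode (n := n) k x) ⊆ F} : ℝ) := by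
          exact_mod_cast (card_le_card hsub).trans
            (card_biUnion_le.trans (sum_le_sum fun k _ => card_biUnion_le))
      _ ≤ ∑ k ∈ range m, ∑ x ∈ univ.filter fun x =>
            k + 2 ≤ (walkClauses (k + 1) (decode (n := n) k x)).card,
            (N.choose m * ((m : ℝ) / N) ^ (k + 2)) := by
          refine sum_le_sum fun k _ => sum_le_sum fun x hx => ?_
          refine (card_superset_div_le _ hm hN).trans ?_
          refine mul_le_mul_of_nonneg_left ?_ hC.le
          exact pow_le_pow_of_le_one (by positivity) hq (mem_filter.1 hx).2
      _ ≤ _ := by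
          refine sum_le_sum fun k _ => ?_
          rw [sum_const, nsmul_eq_mul]
          refine mul_le_mul_of_nonneg_right ?_ (by positivity)
          have : Fintype.card ((Fin (k + 1) → Fin n × Bool) × Fin (k + 2) × Fin (k + 2) × Bool) =
              (2 * n) ^ (k + 1) * ((k + 2) ^ 2 * 2) := by
            simp only [Fintype.card_prod, Fintype.card_fin, Fintype.card_pi, Fintype.card_bool,
              prod_const, card_univ]
            ring
          calc _ ≤ ((Fintype.card
                ((Fin (k + 1) → Fin n × Bool) × Fin (k + 2) × Fin (k + 2) × Bool) : ℕ) : ℝ) := by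
                exact_mod_cast card_le_univ _
            _ = _ := by rw [this]; push_cast; ring
  have hsplit' : (#{F ∈ powersetCard m (univ : Finset (Clause n)) | Sat F} : ℝ) +
      #{F ∈ powersetCard m (univ : Finset (Clause n)) | ¬ Sat F} = N.choose m := by
    exact_mod_cast hsplit
  rw [sub_mul, one_mul, sum_mul]
  have : ∑ k ∈ range m, (2 * n : ℝ) ^ (k + 1) * ((k + 2) ^ 2 * 2) *
        (N.choose m * ((m : ℝ) / N) ^ (k + 2)) = ∑ k ∈ range m, (2 * n : ℝ) ^ (k + 1) *
        ((k + 2) ^ 2 * 2) * ((m : ℝ) / N) ^ (k + 2) * N.choose m :=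
    sum_congr rfl fun k _ => by ring
  linarith

lemma pr_nonneg (Ω : Type*) [Fintype Ω] (P : Ω → Prop) : 0 ≤ pr Ω P := by
  unfold pr
  positivity

lemma pr_le_one (Ω : Type*) [Fintype Ω] (P : Ω → Prop) : pr Ω P ≤ 1 := by
  unfold pr
  refine div_le_one_of_le₀ ?_ (by positivity)
  rw [← Nat.card_eq_fintype_card]
  exact_mod_cast Nat.card_le_card_of_injective _ Subtype.val_injective

lemma tendsto_pr_sat {δ : ℝ} (hδ : 0 ≤ δ) (hδ1 : δ < 1) :
    Tendsto (fun n : ℕ => pr {s : Finset (Clause n) // s.card = ⌊δ * n⌋₊}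
      (fun F => Sat F.val)) atTop (nhds 1) := by
  obtain ⟨ρ, hδρ, hρ1⟩ := exists_between hδ1
  have hρ0 : 0 < ρ := hδ.trans_lt hδρ
  have hsum : Summable fun k : ℕ => 2 * ((k : ℝ) + 2) ^ 2 * ρ ^ (k + 2) := by
    have h1 := summable_pow_mul_geometric_of_norm_lt_one (R := ℝ) 2 (r := ρ)
      (by rwa [Real.norm_of_nonneg hρ0.le])
    have h2 := ((summable_nat_add_iff 2).2 h1).mul_left 2
    refine h2.congr fun k => ?_
    push_cast
    ring
  set S := ∑' k : ℕ, 2 * ((k : ℝ) + 2) ^ 2 * ρ ^ (k + 2) with hS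
  have hlow : ∀ᶠ n : ℕ in atTop, 1 - S / 2 * (n : ℝ)⁻¹ ≤
      pr {s : Finset (Clause n) // s.card = ⌊δ * n⌋₊} (fun F => Sat F.val) := by
    obtain ⟨n₀, hn₀⟩ := exists_nat_gt (ρ / (ρ - δ))
    filter_upwards [eventually_ge_atTop (max 2 n₀)] with n hn
    have hn2 : (2 : ℝ) ≤ n := by exact_mod_cast (le_max_left _ _).trans hn
    have hn0 : (n₀ : ℝ) ≤ n := by exact_mod_cast (le_max_right _ _).trans hn
    have hN := card_clause n
    have hNpos : (0 : ℝ) < Fintype.card (Clause n) := by rw [hN]; nlinarith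
    have hm : (⌊δ * n⌋₊ : ℝ) ≤ δ * n := Nat.floor_le (by positivity)
    have hkey : δ * n ≤ ρ * (n - 1) := by
      have : ρ / (ρ - δ) < n := hn₀.trans_le hn0
      rw [div_lt_iff₀ (by linarith)] at this
      linarith
    have hmN : ⌊δ * n⌋₊ ≤ Fintype.card (Clause n) := by
      have : (⌊δ * n⌋₊ : ℝ) ≤ Fintype.card (Clause n) := by
        rw [hN]
        nlinarith
      exact_mod_cast this
    refine le_trans ?_ (one_sub_sum_le_pr hmN (by exact_mod_cast hNpos))
    have hq : 2 * n * ((⌊δ * n⌋₊ : ℝ) / Fintype.card (Clause n)) ≤ ρ := by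
      rw [mul_div_assoc', div_le_iff₀ hNpos, hN]
      nlinarith
    have hq0 : 0 ≤ 2 * n * ((⌊δ * n⌋₊ : ℝ) / Fintype.card (Clause n)) := by positivity
    have hterm : ∀ k : ℕ, (2 * n : ℝ) ^ (k + 1) * ((k + 2) ^ 2 * 2) *
        ((⌊δ * n⌋₊ : ℝ) / Fintype.card (Clause n)) ^ (k + 2) ≤
        (2 * n : ℝ)⁻¹ * (2 * ((k : ℝ) + 2) ^ 2 * ρ ^ (k + 2)) := by
      intro k
      have h1 := pow_le_pow_left₀ hq0 hq (k + 2)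
      have h2 : (2 * n : ℝ) ^ (k + 1) * ((k + 2) ^ 2 * 2) *
          ((⌊δ * n⌋₊ : ℝ) / Fintype.card (Clause n)) ^ (k + 2) = (2 * n : ℝ)⁻¹ *
          (2 * ((k : ℝ) + 2) ^ 2 *
            (2 * n * ((⌊δ * n⌋₊ : ℝ) / Fintype.card (Clause n))) ^ (k + 2)) := by
        rw [mul_pow (2 * n : ℝ) _ (k + 2), pow_succ (2 * n : ℝ) (k + 1)]
        field_simp
      rw [h2]
      gcongr
    have hfin : ∑ k ∈ range ⌊δ * n⌋₊, (2 * n : ℝ) ^ (k + 1) * ((k + 2) ^ 2 * 2) *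
        ((⌊δ * n⌋₊ : ℝ) / Fintype.card (Clause n)) ^ (k + 2) ≤ (2 * n : ℝ)⁻¹ * S := by
      refine (sum_le_sum fun k _ => hterm k).trans ?_
      rw [← mul_sum]
      gcongr
      exact hsum.sum_le_tsum _ fun k _ => by positivity
    have : (2 * n : ℝ)⁻¹ * S = S / 2 * (n : ℝ)⁻¹ := by
      rw [mul_inv]
      ring
    linarith
  refine tendsto_of_tendsto_of_tendsto_of_le_of_le' ?_ tendsto_const_nhds hlow
    (Eventually.of_forall fun n => pr_le_one _ _)
  have := (tendsto_inv_atTop_nhds_zero_nat (𝕜 := ℝ)).const_mul (S / 2)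
  simpa using this.const_sub 1

section Bernoulli

variable {α : Type*} [Fintype α]

/-- The probability of `F` as a random subset containing every element independently with
probability `p`. -/
def wt (p : ℝ) (F : Finset α) : ℝ := p ^ #F * (1 - p) ^ (Fintype.card α - #F)

lemma wt_nonneg {p : ℝ} (h0 : 0 ≤ p) (h1 : p ≤ 1) (F : Finset α) : 0 ≤ wt p F :=
  mul_nonneg (pow_nonneg h0 _) (pow_nonneg (sub_nonneg.2 h1) _)

lemma sum_Icc_pow_mul_pow [DecidableEq α] {P R : Finset α} (h : P ⊆ R) (x y : ℝ) :
    ∑ F ∈ Icc P R, x ^ (#F - #P) * y ^ (#R - #F) = (x + y) ^ (#R - #P) := by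
  have hd : ∀ G ∈ (R \ P).powerset, Disjoint P G := by
    intro G hG
    rw [mem_powerset] at hG
    exact disjoint_of_subset_right hG disjoint_sdiff
  rw [← card_sdiff_of_subset h, ← sum_pow_mul_eq_add_pow, Icc_eq_image_powerset h, sum_image]
  · refine sum_congr rfl fun G hG => ?_
    have h1 : #(P ∪ G) = #P + #G := card_union_of_disjoint (hd G hG)
    rw [h1, card_sdiff_of_subset h, Nat.add_sub_cancel_left, Nat.sub_sub]
  · intro G hG H hH heq
    simp only at heq
    rw [← (hd G hG).sup_sdiff_cancel_left, ← (hd H hH).sup_sdiff_cancel_left]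
    exact congrArg (· \ P) heq

lemma filter_subset_disjoint [DecidableEq α] (P Q : Finset α) :
    ({F | P ⊆ F ∧ Disjoint Q F} : Finset (Finset α)) = Icc P Qᶜ := by
  ext F
  simp only [mem_filter, mem_univ, true_and, mem_Icc]
  exact and_congr_right fun _ => le_compl_iff_disjoint_left.symm

lemma sum_filter_pow_mul_pow_le [DecidableEq α] (P Q : Finset α) {x y : ℝ} (hx : 0 ≤ x)
    (hy : 0 ≤ y) :
    (∑ F with P ⊆ F ∧ Disjoint Q F, x ^ (#F - #P) * y ^ (Fintype.card α - #F)) * (x + y) ^ #Q ≤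
      y ^ #Q * (x + y) ^ (Fintype.card α - #P) := by
  rw [filter_subset_disjoint]
  by_cases h : P ⊆ Qᶜ
  · have hQ := card_compl_add_card Q
    have hP := card_le_card h
    have : ∀ F ∈ Icc P Qᶜ, x ^ (#F - #P) * y ^ (Fintype.card α - #F) =
        y ^ #Q * (x ^ (#F - #P) * y ^ (#Qᶜ - #F)) := by
      intro F hF
      have := card_le_card (mem_Icc.1 hF).2
      have e : Fintype.card α - #F = #Q + (#Qᶜ - #F) := by omega
      rw [e, pow_add]
      ring
    rw [sum_congr rfl this, ← mul_sum, sum_Icc_pow_mul_pow h, mul_assoc, ← pow_add]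
    have e : #Qᶜ - #P + #Q = Fintype.card α - #P := by omega
    rw [e]
  · rw [Icc_eq_empty h]
    simp only [sum_empty, zero_mul]
    positivity

lemma sum_wt_filter_le [DecidableEq α] (P Q : Finset α) {p : ℝ} (h0 : 0 ≤ p) (h1 : p ≤ 1) :
    ∑ F with P ⊆ F ∧ Disjoint Q F, wt p F ≤ p ^ #P * (1 - p) ^ #Q := by
  have h := sum_filter_pow_mul_pow_le P Q h0 (sub_nonneg.2 h1)
  simp only [add_sub_cancel, one_pow, mul_one] at h
  have : ∑ F with P ⊆ F ∧ Disjoint Q F, wt p F = p ^ #P *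
      ∑ F with P ⊆ F ∧ Disjoint Q F, p ^ (#F - #P) * (1 - p) ^ (Fintype.card α - #F) := by
    rw [mul_sum]
    refine sum_congr rfl fun F hF => ?_
    have := card_le_card (mem_filter.1 hF).2.1
    rw [wt, ← mul_assoc, ← pow_add, Nat.add_sub_cancel' this]
  rw [this]
  exact mul_le_mul_of_nonneg_left h (pow_nonneg h0 _)

lemma sum_wt (p : ℝ) : ∑ F : Finset α, wt p F = 1 := by
  classical
  have := sum_pow_mul_eq_add_pow p (1 - p) (univ : Finset α)
  simpa [wt] using this

lemma sum_card_mul_wt_le {p : ℝ} (h0 : 0 ≤ p) (h1 : p ≤ 1) :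
    ∑ F : Finset α, #F * wt p F ≤ Fintype.card α * p := by
  classical
  calc ∑ F : Finset α, #F * wt p F
      = ∑ F : Finset α, ∑ C : α, if C ∈ F then wt p F else 0 := by
        refine sum_congr rfl fun F _ => ?_
        rw [← sum_filter]
        simp
    _ = ∑ C : α, ∑ F with C ∈ F, wt p F := by
        rw [sum_comm]
        exact sum_congr rfl fun C _ => by rw [sum_filter]
    _ ≤ ∑ C : α, p := by
        refine sum_le_sum fun C _ => ?_
        simpa using sum_wt_filter_le {C} ∅ h0 h1
    _ = _ := by simp

lemma one_sub_le_sum_wt {p : ℝ} (h0 : 0 ≤ p) (h1 : p ≤ 1) (m : ℕ) :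
    1 - Fintype.card α * p / (m + 1) ≤ ∑ F : Finset α with #F ≤ m, wt p F := by
  have hs : ∑ F : Finset α with #F ≤ m, wt p F + ∑ F : Finset α with ¬ #F ≤ m, wt p F = 1 := by
    rw [sum_filter_add_sum_filter_not, sum_wt]
  have hm : (∑ F : Finset α with ¬ #F ≤ m, wt p F) * (m + 1) ≤ Fintype.card α * p := by
    refine le_trans ?_ (sum_card_mul_wt_le h0 h1)
    rw [sum_mul]
    refine le_trans (sum_le_sum fun F hF => ?_) (sum_le_sum_of_subset_of_nonneg
      (filter_subset (fun F : Finset α => ¬ #F ≤ m) univ) fun F _ _ =>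
        mul_nonneg (Nat.cast_nonneg _) (wt_nonneg h0 h1 F))
    rw [mul_comm]
    refine mul_le_mul_of_nonneg_right ?_ (wt_nonneg h0 h1 F)
    have : m + 1 ≤ #F := by
      have := (mem_filter.1 hF).2
      omega
    exact_mod_cast this
  rw [← le_div_iff₀ (by positivity)] at hm
  linarith

open Classical in
lemma density_antitone {A : Finset α → Prop} (hA : ∀ F G, F ⊆ G → A G → A F) {k m : ℕ}
    (hkm : k ≤ m) :
    (#{F ∈ powersetCard m univ | A F} : ℝ) / (Fintype.card α).choose m ≤
      (#{F ∈ powersetCard k univ | A F} : ℝ) / (Fintype.card α).choose k := by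
  induction m, hkm using Nat.le_induction with
  | base => exact le_rfl
  | succ m hkm ih =>
    refine le_trans ?_ ih
    refine (local_lubell_yamamoto_meshalkin_inequality_div (𝕜 := ℝ) (r := m + 1) (by omega)
      (𝒜 := {F ∈ powersetCard (m + 1) univ | A F}) ?_).trans ?_
    · intro F hF
      simpa using (mem_filter.1 hF).1
    · rw [Nat.add_sub_cancel]
      gcongr
      intro F hF
      obtain ⟨G, hG, a, ha, rfl⟩ := mem_shadow_iff.1 hF
      rw [mem_filter, mem_powersetCard_univ] at hG ⊢
      refine ⟨?_, hA _ _ (erase_subset _ _) hG.2⟩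
      rw [card_erase_of_mem ha, hG.1, Nat.add_sub_cancel]

open Classical in
lemma density_mul_le {A : Finset α → Prop} (hA : ∀ F G, F ⊆ G → A G → A F) {p : ℝ} (h0 : 0 ≤ p)
    (h1 : p ≤ 1) (m : ℕ) :
    (#{F ∈ powersetCard m univ | A F} : ℝ) / (Fintype.card α).choose m *
      (1 - Fintype.card α * p / (m + 1)) ≤ ∑ F with A F, wt p F := by
  set N := Fintype.card α with hN
  set d := (#{F ∈ powersetCard m univ | A F} : ℝ) / N.choose m with hd
  have hlevel : ∀ (B : Finset α → Prop) [DecidablePred B], ∑ F with #F ≤ m ∧ B F, wt p F =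
      ∑ k ∈ range (m + 1), #{F ∈ powersetCard k univ | B F} * (p ^ k * (1 - p) ^ (N - k)) := by
    intro B _
    rw [← sum_fiberwise_of_maps_to (g := fun F : Finset α => #F) (t := range (m + 1))]
    · refine sum_congr rfl fun k hk => ?_
      rw [← nsmul_eq_mul, ← sum_const]
      have hk' : k ≤ m := by
        have := mem_range.1 hk
        omega
      refine sum_congr ?_ fun F hF => ?_
      · ext F
        simp only [mem_filter, mem_univ, true_and, mem_powersetCard_univ]
        constructor
        · rintro ⟨⟨-, h⟩, h'⟩
          exact ⟨h', h⟩
        · rintro ⟨h', h⟩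
          exact ⟨⟨by omega, h⟩, h'⟩
      · rw [mem_filter, mem_powersetCard_univ] at hF
        rw [wt, hF.1]
    · intro F hF
      have := (mem_filter.1 hF).2.1
      rw [mem_range]
      omega
  calc d * (1 - N * p / (m + 1))
      ≤ d * ∑ F : Finset α with #F ≤ m, wt p F :=
        mul_le_mul_of_nonneg_left (one_sub_le_sum_wt h0 h1 m) (by positivity)
    _ = d * ∑ F : Finset α with #F ≤ m ∧ True, wt p F := by simp
    _ = ∑ k ∈ range (m + 1), d * (N.choose k * (p ^ k * (1 - p) ^ (N - k))) := by
        rw [hlevel, mul_sum]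
        simp [hN]
    _ ≤ ∑ k ∈ range (m + 1), #{F ∈ powersetCard k univ | A F} * (p ^ k * (1 - p) ^ (N - k)) := by
        refine sum_le_sum fun k hk => ?_
        rw [← mul_assoc]
        refine mul_le_mul_of_nonneg_right ?_
          (mul_nonneg (pow_nonneg h0 _) (pow_nonneg (sub_nonneg.2 h1) _))
        have hk' : k ≤ m := by
          have := mem_range.1 hk
          omega
        rcases Nat.eq_zero_or_pos (N.choose k) with h | h
        · rw [h]
          simp
        · rw [← le_div_iff₀ (by exact_mod_cast h)]
          exact density_antitone hA hk'
    _ = ∑ F with #F ≤ m ∧ A F, wt p F := (hlevel A).symm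
    _ ≤ _ := by
        refine sum_le_sum_of_subset_of_nonneg ?_ fun F _ _ => wt_nonneg h0 h1 F
        intro F hF
        simp only [mem_filter, mem_univ, true_and] at hF ⊢
        exact hF.2

open Classical in
/-- Two-round exposure: the random set of density `p₁ + p₂` contains one of density `p₁`, and if
the latter satisfies `G`, then the former has to avoid one of two large sets to satisfy `A`. -/
lemma sum_wt_two_round {A G : Finset α → Prop} {K : ℕ} {p₁ p₂ : ℝ} (h1 : 0 ≤ p₁) (h2 : 0 ≤ p₂)
    (h12 : p₁ + p₂ < 1)
    (hG : ∀ F₁, G F₁ → ∃ X Y : Finset α, K ≤ #X ∧ K ≤ #Y ∧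
      ∀ F, F₁ ⊆ F → A F → Disjoint X F ∨ Disjoint Y F) :
    ∑ F with A F, wt (p₁ + p₂) F ≤ ∑ F with ¬ G F, wt p₁ F + 2 * (1 - p₂) ^ K := by
  set N := Fintype.card α with hN
  set q := 1 - (p₁ + p₂) with hq
  have hq0 : 0 < q := by linarith
  have hpq : p₂ + q = 1 - p₁ := by rw [hq]; ring
  let inner : Finset α → ℝ := fun F₁ =>
    ∑ F with F₁ ⊆ F ∧ A F, p₂ ^ (#F - #F₁) * q ^ (N - #F)
  have hmerge : ∑ F with A F, wt (p₁ + p₂) F = ∑ F₁, p₁ ^ #F₁ * inner F₁ := by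
    simp only [wt, inner]
    calc ∑ F with A F, (p₁ + p₂) ^ #F * (1 - (p₁ + p₂)) ^ (Fintype.card α - #F)
        = ∑ F, ∑ F₁, if F₁ ⊆ F ∧ A F then p₁ ^ #F₁ * (p₂ ^ (#F - #F₁) * q ^ (N - #F)) else 0 := by
          rw [sum_filter]
          refine sum_congr rfl fun F _ => ?_
          by_cases hF : A F
          · simp only [hF, if_true, and_true]
            rw [← sum_filter, ← sum_pow_mul_eq_add_pow, sum_mul]
            refine sum_congr ?_ fun F₁ _ => by rw [mul_assoc]
            ext
            simp
          · simp [hF]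
      _ = _ := by
          rw [sum_comm]
          refine sum_congr rfl fun F₁ _ => ?_
          rw [← sum_filter, mul_sum]
  have hterm : ∀ F₁ F : Finset α, 0 ≤ p₂ ^ (#F - #F₁) * q ^ (N - #F) := fun F₁ F =>
    mul_nonneg (pow_nonneg h2 _) (pow_nonneg hq0.le _)
  have havoid : ∀ F₁ X : Finset α, K ≤ #X →
      ∑ F with F₁ ⊆ F ∧ Disjoint X F, p₂ ^ (#F - #F₁) * q ^ (N - #F) ≤
        (1 - p₁) ^ (N - #F₁) * (1 - p₂) ^ K := by
    intro F₁ X hX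
    have h := sum_filter_pow_mul_pow_le F₁ X h2 hq0.le
    rw [hpq] at h
    have hp1 : 0 < (1 - p₁) ^ #X := pow_pos (by linarith) _
    rw [← le_div_iff₀ hp1] at h
    refine h.trans ?_
    rw [div_le_iff₀ hp1]
    have h3 : q ^ #X ≤ (1 - p₂) ^ K * (1 - p₁) ^ #X := by
      calc q ^ #X ≤ ((1 - p₂) * (1 - p₁)) ^ #X :=
            pow_le_pow_left₀ hq0.le (by rw [hq]; nlinarith [mul_nonneg h1 h2]) _
        _ = (1 - p₂) ^ #X * (1 - p₁) ^ #X := mul_pow _ _ _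
        _ ≤ _ := mul_le_mul_of_nonneg_right
            (pow_le_pow_of_le_one (by linarith) (by linarith) hX) hp1.le
    calc q ^ #X * (1 - p₁) ^ (N - #F₁)
        ≤ (1 - p₂) ^ K * (1 - p₁) ^ #X * (1 - p₁) ^ (N - #F₁) :=
          mul_le_mul_of_nonneg_right h3 (pow_nonneg (by linarith) _)
      _ = _ := by ring
  have hgood : ∀ F₁, G F₁ → inner F₁ ≤ (1 - p₁) ^ (N - #F₁) * (2 * (1 - p₂) ^ K) := by
    intro F₁ hF₁
    obtain ⟨X, Y, hX, hY, hXY⟩ := hG F₁ hF₁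
    have hsub : ({F | F₁ ⊆ F ∧ A F} : Finset (Finset α)) ⊆
        ({F | F₁ ⊆ F ∧ Disjoint X F} : Finset (Finset α)) ∪
        ({F | F₁ ⊆ F ∧ Disjoint Y F} : Finset (Finset α)) := by
      intro F hF
      simp only [mem_union, mem_filter, mem_univ, true_and] at hF ⊢
      rcases hXY F hF.1 hF.2 with h | h
      · exact Or.inl ⟨hF.1, h⟩
      · exact Or.inr ⟨hF.1, h⟩
    have h3 := havoid F₁ X hX
    have h4 := havoid F₁ Y hY
    have h5 : inner F₁ ≤ _ := sum_le_sum_of_subset_of_nonneg hsub fun F _ _ => hterm F₁ F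
    have h6 := sum_union_inter (s₁ := ({F | F₁ ⊆ F ∧ Disjoint X F} : Finset (Finset α)))
      (s₂ := ({F | F₁ ⊆ F ∧ Disjoint Y F} : Finset (Finset α)))
      (f := fun F => p₂ ^ (#F - #F₁) * q ^ (N - #F))
    have h7 : 0 ≤ ∑ F ∈ ({F | F₁ ⊆ F ∧ Disjoint X F} : Finset (Finset α)) ∩
        ({F | F₁ ⊆ F ∧ Disjoint Y F} : Finset (Finset α)),
        p₂ ^ (#F - #F₁) * q ^ (N - #F) := sum_nonneg fun F _ => hterm F₁ F
    linarith
  have hbad : ∀ F₁, inner F₁ ≤ (1 - p₁) ^ (N - #F₁) := by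
    intro F₁
    have h := sum_filter_pow_mul_pow_le F₁ ∅ h2 hq0.le
    simp only [card_empty, pow_zero, mul_one, one_mul, hpq] at h
    refine le_trans (sum_le_sum_of_subset_of_nonneg ?_ fun F _ _ => hterm F₁ F) h
    intro F hF
    simp only [mem_filter, mem_univ, true_and, disjoint_empty_left, and_true] at hF ⊢
    exact hF.1
  have hK : 0 ≤ (1 - p₂) ^ K := pow_nonneg (by linarith) _
  rw [hmerge]
  calc ∑ F₁, p₁ ^ #F₁ * inner F₁
      ≤ ∑ F₁, ((if ¬ G F₁ then wt p₁ F₁ else 0) + wt p₁ F₁ * (2 * (1 - p₂) ^ K)) := by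
        refine sum_le_sum fun F₁ _ => ?_
        have hw := wt_nonneg h1 (by linarith : p₁ ≤ 1) F₁
        by_cases hF : G F₁
        · simp only [hF, not_true, if_false, zero_add]
          rw [wt, mul_assoc]
          exact mul_le_mul_of_nonneg_left (hgood F₁ hF) (pow_nonneg h1 _)
        · simp only [hF, not_false_eq_true, if_true]
          have := mul_le_mul_of_nonneg_left (hbad F₁) (pow_nonneg h1 #F₁)
          have h9 : p₁ ^ #F₁ * (1 - p₁) ^ (N - #F₁) = wt p₁ F₁ := rfl
          have : 0 ≤ wt p₁ F₁ * (2 * (1 - p₂) ^ K) := by positivity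
          linarith
    _ = _ := by rw [sum_add_distrib, ← sum_filter, ← sum_mul, sum_wt, one_mul]

end Bernoulli

/-- The clauses consisting of a literal in `X` and a literal in `Y`. -/
noncomputable def clausesBetween (X Y : Finset (Fin n × Bool)) : Finset (Clause n) := by
  classical exact univ.filter fun C => ∃ a ∈ X, ∃ b ∈ Y, IsClause C a b

lemma mem_clausesBetween {X Y : Finset (Fin n × Bool)} {C : Clause n} :
    C ∈ clausesBetween X Y ↔ ∃ a ∈ X, ∃ b ∈ Y, IsClause C a b := by
  simp [clausesBetween]

lemma card_mul_card_le_card_clausesBetween {X Y : Finset (Fin n × Bool)}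
    (h : ∀ a ∈ X, ∀ b ∈ Y, a.1 ≠ b.1) : #X * #Y ≤ #(clausesBetween X Y) := by
  classical
  rw [← card_product]
  refine card_le_card_of_surjOn (fun C : Clause n => if C.val.1 ∈ X then C.val else C.val.swap) ?_
  rintro ⟨a, b⟩ hab
  simp only [coe_product, Set.mem_prod, mem_coe] at hab
  obtain ⟨C, hC⟩ := exists_isClause (h a hab.1 b hab.2)
  refine ⟨C, mem_clausesBetween.2 ⟨a, hab.1, b, hab.2, hC⟩, ?_⟩
  rcases hC with hC | hC
  · simp [hC, hab.1]
  · have : b ∉ X := fun hb => h b hb b hab.2 rfl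
    simp [hC, this]

/-- The implication digraph contains a path on `L` literals with distinct variables; the literals
are listed from the end of the path to its start. -/
def HasPath (F : Finset (Clause n)) (L : ℕ) : Prop :=
  ∃ U : List (Fin n × Bool), U.length = L ∧ (U.map Prod.fst).Nodup ∧
    U.IsChain fun a b => Imp F b a

lemma Imp.mono {F G : Finset (Clause n)} (h : F ⊆ G) {u v : Fin n × Bool} (huv : Imp F u v) :
    Imp G u v := by
  obtain ⟨C, hC, h'⟩ := huv
  exact ⟨C, h hC, h'⟩

lemma isChain_imp_mono {F G : Finset (Clause n)} (h : F ⊆ G) {U : List (Fin n × Bool)}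
    (hU : U.IsChain fun a b => Imp F b a) : U.IsChain fun a b => Imp G b a :=
  hU.imp fun _ _ hab => hab.mono h

lemma isChain_imp_pairwise {F : Finset (Clause n)} {σ : Fin n → Bool}
    (hσ : ∀ C ∈ F, clauseSat σ C) {U : List (Fin n × Bool)}
    (hU : U.IsChain fun a b => Imp F b a) :
    U.Pairwise fun a b => litVal σ b = true → litVal σ a = true := by
  have h : U.IsChain fun a b => litVal σ b = true → litVal σ a = true :=
    hU.imp fun _ _ hab hb => hab.litVal hσ hb
  have : IsTrans (Fin n × Bool) fun a b => litVal σ b = true → litVal σ a = true :=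
    ⟨fun _ _ _ h1 h2 h3 => h1 (h2 h3)⟩
  exact h.pairwise

lemma card_clausesBetween_toFinset {A B : List (Fin n × Bool)} {h : ℕ}
    (hd : ((A ++ B).map Prod.fst).Nodup) (hA : A.length = h) (hB : B.length = h) :
    h ^ 2 ≤ #(clausesBetween A.toFinset B.toFinset) := by
  rw [List.map_append, List.nodup_append] at hd
  have hcard : ∀ {D : List (Fin n × Bool)}, (D.map Prod.fst).Nodup → #D.toFinset = D.length :=
    fun hD => List.toFinset_card_of_nodup hD.of_map
  have := card_mul_card_le_card_clausesBetween (X := A.toFinset) (Y := B.toFinset) ?_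
  · rwa [hcard hd.1, hcard hd.2.1, hA, hB, ← sq] at this
  · intro a ha b hb
    rw [List.mem_toFinset] at ha hb
    exact hd.2.2 _ (List.mem_map_of_mem ha) _ (List.mem_map_of_mem hb)

lemma exists_split {U : List (Fin n × Bool)} {k l : ℕ} (h : U.length = k + l) :
    ∃ A B, A ++ B = U ∧ A.length = k ∧ B.length = l :=
  ⟨U.take k, U.drop k, List.take_append_drop k U, by simp [h], by simp [h]⟩

/-- A satisfiable 2-CNF with a long path avoids one of two large sets of clauses. -/
lemma HasPath.disjoint_or {F₁ : Finset (Clause n)} {h : ℕ} (hF : HasPath F₁ (4 * h)) :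
    ∃ X Y : Finset (Clause n), h ^ 2 ≤ #X ∧ h ^ 2 ≤ #Y ∧
      ∀ F, F₁ ⊆ F → Sat F → Disjoint X F ∨ Disjoint Y F := by
  classical
  obtain ⟨U, hlen, hnd, hch⟩ := hF
  obtain ⟨U₁, U₂, rfl, h1, h2⟩ := exists_split (k := 2 * h) (l := 2 * h) (by omega : U.length = _)
  obtain ⟨A, B, rfl, hA, hB⟩ := exists_split (k := h) (l := h) (by omega : U₁.length = _)
  obtain ⟨C, D, rfl, hC, hD⟩ := exists_split (k := h) (l := h) (by omega : U₂.length = _)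
  have hnd' := hnd
  rw [List.map_append, List.nodup_append] at hnd'
  have hneg : ∀ V : List (Fin n × Bool), (V.map neg).map Prod.fst = V.map Prod.fst := by
    intro V
    rw [List.map_map]
    rfl
  refine ⟨clausesBetween (A.map neg).toFinset (B.map neg).toFinset,
    clausesBetween C.toFinset D.toFinset, ?_, card_clausesBetween_toFinset hnd'.2.1 hC hD, ?_⟩
  · refine card_clausesBetween_toFinset ?_ (by simpa using hA) (by simpa using hB)
    rw [← List.map_append, hneg]
    exact hnd'.1
  · rintro F hsub ⟨σ, hσ⟩
    by_contra! hc
    obtain ⟨⟨E, hEX, hE⟩, E', hEY, hE'⟩ :=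
      And.intro (not_disjoint_iff.1 hc.1) (not_disjoint_iff.1 hc.2)
    obtain ⟨a, ha, b, hb, hab⟩ := mem_clausesBetween.1 hEX
    obtain ⟨c, hc, d, hd, hcd⟩ := mem_clausesBetween.1 hEY
    simp only [List.mem_toFinset, List.mem_map] at ha hb hc hd
    obtain ⟨a, ha, rfl⟩ := ha
    obtain ⟨b, hb, rfl⟩ := hb
    have hp := List.pairwise_append.1 (isChain_imp_pairwise hσ (isChain_imp_mono hsub hch))
    obtain ⟨u, hu, hut⟩ : ∃ u ∈ C ++ D, litVal σ u = true := by
      rcases hcd.sat (hσ _ hE') with h | h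
      · exact ⟨c, by simp [hc], h⟩
      · exact ⟨d, by simp [hd], h⟩
    have hat := hp.2.2 a (by simp [ha]) u hu hut
    have hbt := hp.2.2 b (by simp [hb]) u hu hut
    rcases hab.sat (hσ _ hE) with h | h
    · simp [litVal_neg, hat] at h
    · simp [litVal_neg, hbt] at h

/-- The state of a depth first search of the implication digraph: `P` and `Q` are the clauses that
have been queried and found present and absent, respectively, `U` is the stack, `S` is the set of
finished literals, and `T` is the set of variables that have not been visited. -/
structure SearchState (P Q : Finset (Clause n)) (U : List (Fin n × Bool))
    (S : Finset (Fin n × Bool)) (T : Finset (Fin n)) : Prop where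
  nodup : (U.map Prod.fst).Nodup
  stack_notMem : ∀ u ∈ U, u.1 ∉ T
  stack_notMem_done : ∀ u ∈ U, u ∉ S
  done_notMem : ∀ s ∈ S, s.1 ∉ T
  card : U.length + #S + #T = n
  chain : U.IsChain fun a b => Imp P b a
  present_notMem : ∀ C ∈ P, C.val.1.1 ∉ T ∧ C.val.2.1 ∉ T
  tested : ∀ s ∈ S, ∀ l : Fin n × Bool, l.1 ∈ T → ∀ C, IsClause C (neg s) l → C ∈ Q
  card_present : #P + #T ≤ n

namespace SearchState

variable {P Q : Finset (Clause n)} {U : List (Fin n × Bool)} {S : Finset (Fin n × Bool)}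
  {T : Finset (Fin n)}

lemma initial : SearchState (n := n) ∅ ∅ [] ∅ univ := by
  constructor <;> simp

lemma push_root (h : SearchState P Q [] S T) {x : Fin n} (hx : x ∈ T) :
    SearchState P Q [(x, true)] S (T.erase x) where
  nodup := by simp
  stack_notMem := by simp
  stack_notMem_done := by
    intro u hu hS
    rw [List.mem_singleton] at hu
    subst hu
    exact h.done_notMem _ hS hx
  done_notMem s hs hT := h.done_notMem s hs (mem_of_mem_erase hT)
  card := by
    have := h.card
    have := card_pos.2 ⟨x, hx⟩
    rw [card_erase_of_mem hx]
    simp only [List.length_nil, List.length_singleton] at *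
    omega
  chain := by simp
  present_notMem C hC :=
    ⟨fun hT => (h.present_notMem C hC).1 (mem_of_mem_erase hT),
      fun hT => (h.present_notMem C hC).2 (mem_of_mem_erase hT)⟩
  tested s hs l hl := h.tested s hs l (mem_of_mem_erase hl)
  card_present := by
    have := h.card_present
    rw [card_erase_of_mem hx]
    omega

lemma pop {w : Fin n × Bool} (h : SearchState P Q (w :: U) S T)
    (hw : ∀ l : Fin n × Bool, l.1 ∈ T → ∀ C, IsClause C (neg w) l → C ∈ Q) :
    SearchState P Q U (insert w S) T where
  nodup := (List.nodup_cons.1 h.nodup).2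
  stack_notMem u hu := h.stack_notMem u (List.mem_cons_of_mem _ hu)
  stack_notMem_done u hu hS := by
    rcases mem_insert.1 hS with rfl | hS
    · exact (List.nodup_cons.1 h.nodup).1 (List.mem_map_of_mem hu)
    · exact h.stack_notMem_done u (List.mem_cons_of_mem _ hu) hS
  done_notMem s hs := by
    rcases mem_insert.1 hs with rfl | hs
    · exact h.stack_notMem _ List.mem_cons_self
    · exact h.done_notMem s hs
  card := by
    have := h.card
    rw [card_insert_of_notMem (h.stack_notMem_done w List.mem_cons_self)]
    rw [List.length_cons] at this
    omega
  chain := h.chain.tail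
  present_notMem := h.present_notMem
  tested s hs := by
    rcases mem_insert.1 hs with rfl | hs
    · exact hw
    · exact h.tested s hs
  card_present := h.card_present

lemma push {w l : Fin n × Bool} {C : Clause n} (h : SearchState P Q (w :: U) S T)
    (hl : l.1 ∈ T) (hC : IsClause C (neg w) l) :
    SearchState (insert C P) Q (l :: w :: U) S (T.erase l.1) where
  nodup := by
    rw [List.map_cons, List.nodup_cons]
    refine ⟨fun hmem => ?_, h.nodup⟩
    obtain ⟨u, hu, hul⟩ := List.mem_map.1 hmem
    exact h.stack_notMem u hu (hul ▸ hl)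
  stack_notMem u hu hT := by
    rcases List.mem_cons.1 hu with rfl | hu
    · simp at hT
    · exact h.stack_notMem u hu (mem_of_mem_erase hT)
  stack_notMem_done u hu hS := by
    rcases List.mem_cons.1 hu with rfl | hu
    · exact h.done_notMem _ hS hl
    · exact h.stack_notMem_done u hu hS
  done_notMem s hs hT := h.done_notMem s hs (mem_of_mem_erase hT)
  card := by
    have := h.card
    have := card_pos.2 ⟨_, hl⟩
    rw [card_erase_of_mem hl]
    simp only [List.length_cons] at *
    omega
  chain := by
    rw [List.isChain_cons_cons]
    exact ⟨⟨C, mem_insert_self _ _, hC⟩, isChain_imp_mono (subset_insert _ _) h.chain⟩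
  present_notMem D hD := by
    rcases mem_insert.1 hD with rfl | hD
    · have hw : w.1 ∉ T.erase l.1 := fun hT =>
        h.stack_notMem w List.mem_cons_self (mem_of_mem_erase hT)
      have hl' : l.1 ∉ T.erase l.1 := notMem_erase _ _
      rcases hC with hC | hC <;> rw [hC]
      · exact ⟨hw, hl'⟩
      · exact ⟨hl', hw⟩
    · exact ⟨fun hT => (h.present_notMem D hD).1 (mem_of_mem_erase hT),
        fun hT => (h.present_notMem D hD).2 (mem_of_mem_erase hT)⟩
  tested s hs l hl := h.tested s hs l (mem_of_mem_erase hl)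
  card_present := by
    have := h.card_present
    have := card_insert_le C P
    have := card_pos.2 ⟨_, hl⟩
    rw [card_erase_of_mem hl]
    omega

lemma absent (h : SearchState P Q U S T) (C : Clause n) : SearchState P (insert C Q) U S T where
  nodup := h.nodup
  stack_notMem := h.stack_notMem
  stack_notMem_done := h.stack_notMem_done
  done_notMem := h.done_notMem
  card := h.card
  chain := h.chain
  present_notMem := h.present_notMem
  tested s hs l hl D hD := mem_insert_of_mem (h.tested s hs l hl D hD)
  card_present := h.card_present

lemma card_absent (h : SearchState P Q U S T) : #S * (2 * #T) ≤ #Q := by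
  classical
  have hsub : clausesBetween (S.image neg) (T ×ˢ univ) ⊆ Q := by
    intro C hC
    obtain ⟨a, ha, b, hb, hab⟩ := mem_clausesBetween.1 hC
    obtain ⟨s, hs, rfl⟩ := mem_image.1 ha
    exact h.tested s hs b (mem_product.1 hb).1 C hab
  refine le_trans ?_ (card_le_card hsub)
  refine le_trans (le_of_eq ?_) (card_mul_card_le_card_clausesBetween ?_)
  · rw [card_image_of_injective _ (Function.LeftInverse.injective neg_neg), card_product]
    simp [mul_comm]
  · intro a ha b hb hab
    obtain ⟨s, hs, rfl⟩ := mem_image.1 ha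
    rw [neg_fst] at hab
    exact h.done_notMem s hs (hab ▸ (mem_product.1 hb).1)

open Classical in
lemma sum_wt_le {L v : ℕ} (hv : v ≤ n) {p θ r : ℝ} (hp0 : 0 ≤ p) (hp1 : p ≤ 1) (hθ0 : 0 ≤ θ)
    (hθ1 : θ ≤ 1) (hr : 1 ≤ r) (hpr : p * θ + (1 - p) * r ≤ 1) (h : SearchState P Q U S T)
    (hT : n - v ≤ #T) (hU : U.length ≤ L) :
    (∑ F with (P ⊆ F ∧ Disjoint Q F) ∧ ¬ HasPath F L, wt p F) *
      (θ ^ v * r ^ ((v - L) * (2 * (n - v)))) ≤ (p * θ) ^ #P * ((1 - p) * r) ^ #Q := by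
  have hq0 : 0 ≤ 1 - p := sub_nonneg.2 hp1
  have hr0 : 0 ≤ r := zero_le_one.trans hr
  induction hμ : 2 * #T + U.length + (Fintype.card (Clause n) - #Q) using Nat.strong_induction_on
    generalizing P Q U S T with
  | _ μ ih =>
  by_cases hUL : U.length = L
  · have : ({F | (P ⊆ F ∧ Disjoint Q F) ∧ ¬ HasPath F L} : Finset (Finset (Clause n))) = ∅ := by
      rw [filter_eq_empty_iff]
      rintro F - ⟨⟨hPF, -⟩, hF⟩
      exact hF ⟨U, hUL, h.nodup, isChain_imp_mono hPF h.chain⟩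
    rw [this, sum_empty, zero_mul]
    positivity
  by_cases hTv : #T = n - v
  · have hcard := h.card
    have hP := h.card_present
    have hQ : (v - L) * (2 * (n - v)) ≤ #Q := by
      refine le_trans ?_ h.card_absent
      rw [hTv]
      exact Nat.mul_le_mul_right _ (by omega)
    calc (∑ F with (P ⊆ F ∧ Disjoint Q F) ∧ ¬ HasPath F L, wt p F) *
          (θ ^ v * r ^ ((v - L) * (2 * (n - v))))
        ≤ (p ^ #P * (1 - p) ^ #Q) * (θ ^ #P * r ^ #Q) := by
          refine mul_le_mul ?_ ?_ (by positivity) (by positivity)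
          · refine le_trans (sum_le_sum_of_subset_of_nonneg ?_ fun F _ _ => wt_nonneg hp0 hp1 F)
              (sum_wt_filter_le P Q hp0 hp1)
            intro F hF
            rw [mem_filter] at hF ⊢
            exact ⟨hF.1, hF.2.1⟩
          · exact mul_le_mul (pow_le_pow_of_le_one hθ0 hθ1 (by omega))
              (pow_le_pow_right₀ hr hQ) (by positivity) (by positivity)
      _ = _ := by
          rw [mul_pow, mul_pow]
          ring
  cases U with
  | nil =>
    obtain ⟨x, hx⟩ : T.Nonempty := card_pos.1 (by omega)
    have hTx := card_erase_of_mem hx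
    have hTpos := card_pos.2 ⟨x, hx⟩
    simp only [List.length_nil] at hU hUL hμ
    refine ih _ ?_ (h.push_root hx) (by omega) ?_ rfl <;> simp only [List.length_singleton] <;> omega
  | cons w U =>
    simp only [List.length_cons] at hU hUL hμ
    by_cases hw : ∀ l : Fin n × Bool, l.1 ∈ T → ∀ C, IsClause C (neg w) l → C ∈ Q
    · exact ih _ (by omega) (h.pop hw) hT (by omega) rfl
    · push Not at hw
      obtain ⟨l, hl, C, hC, hCQ⟩ := hw
      have hCP : C ∉ P := by
        intro hCP
        have := h.present_notMem C hCP
        rcases hC with hC | hC <;> rw [hC] at this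
        · exact this.2 hl
        · exact this.1 hl
      have hTl := card_erase_of_mem hl
      have hTpos := card_pos.2 ⟨_, hl⟩
      have hQC := card_insert_of_notMem hCQ
      have hQle := card_le_univ (insert C Q)
      have hyes := ih _ (by simp only [List.length_cons]; omega) (h.push hl hC) (by omega)
        (by simp only [List.length_cons]; omega) rfl
      have hno := ih _ (by simp only [List.length_cons]; omega) (h.absent C) hT
        (by simp only [List.length_cons]; omega) rfl
      rw [card_insert_of_notMem hCP] at hyes
      rw [hQC] at hno
      have hsplit : ∑ F with (P ⊆ F ∧ Disjoint Q F) ∧ ¬ HasPath F L, wt p F =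
          ∑ F with (insert C P ⊆ F ∧ Disjoint Q F) ∧ ¬ HasPath F L, wt p F +
          ∑ F with (P ⊆ F ∧ Disjoint (insert C Q) F) ∧ ¬ HasPath F L, wt p F := by
        rw [← sum_filter_add_sum_filter_not _ (fun F => C ∈ F), filter_filter, filter_filter]
        congr 2 <;> ext F <;>
          simp only [mem_filter, mem_univ, true_and, insert_subset_iff, disjoint_insert_left] <;>
          tauto
      rw [hsplit, add_mul]
      refine (add_le_add hyes hno).trans ?_
      have : (p * θ) ^ (#P + 1) * ((1 - p) * r) ^ #Q + (p * θ) ^ #P * ((1 - p) * r) ^ (#Q + 1) =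
          (p * θ + (1 - p) * r) * ((p * θ) ^ #P * ((1 - p) * r) ^ #Q) := by ring
      rw [this]
      exact mul_le_of_le_one_left (by positivity) hpr

end SearchState

open Classical in
lemma sum_wt_not_hasPath_le {L v : ℕ} (hv : v ≤ n) {p θ r : ℝ} (hp0 : 0 ≤ p) (hp1 : p ≤ 1)
    (hθ0 : 0 ≤ θ) (hθ1 : θ ≤ 1) (hr : 1 ≤ r) (hpr : p * θ + (1 - p) * r ≤ 1) :
    (∑ F : Finset (Clause n) with ¬ HasPath F L, wt p F) *
      (θ ^ v * r ^ ((v - L) * (2 * (n - v)))) ≤ 1 := by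
  simpa using SearchState.initial.sum_wt_le (L := L) hv hp0 hp1 hθ0 hθ1 hr hpr (by simp) (by simp)

open Classical in
/-- Above density `1 / (2n)`, long paths exist with probability exponentially close to `1`. -/
lemma sum_wt_not_hasPath_le_exp {L v : ℕ} (hv : v ≤ n) {p s y : ℝ} (hp0 : 0 ≤ p) (hp1 : p ≤ 1)
    (hs : 0 ≤ s) (hy0 : 0 ≤ y) (hy1 : y < 1) (hsy : y * (2 + 2 * s) ≤ s)
    (hpv : (1 + 2 * s) * v ≤ p * ((v - L : ℕ) * (2 * (n - v : ℕ)) : ℕ)) :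
    ∑ F : Finset (Clause n) with ¬ HasPath F L, wt p F ≤ Real.exp (-(v * y * s)) := by
  set q := (v - L) * (2 * (n - v)) with hq
  have hpy : 0 ≤ p * y := by positivity
  have h := sum_wt_not_hasPath_le (L := L) hv hp0 hp1 (sub_nonneg.2 hy1.le) (by linarith)
    (r := 1 + p * y) (by linarith) (by nlinarith [mul_nonneg hp0 hpy])
  rw [← hq] at h
  have h1 : Real.exp (-(y / (1 - y))) ≤ 1 - y := by
    rw [← Real.le_log_iff_exp_le (by linarith)]
    refine le_trans (le_of_eq ?_) (Real.one_sub_inv_le_log_of_pos (by linarith))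
    have : 1 - y ≠ 0 := by linarith
    field_simp
    ring
  have h2 : Real.exp (p * y / (1 + y)) ≤ 1 + p * y := by
    rw [← Real.le_log_iff_exp_le (by linarith)]
    refine le_trans ?_ (Real.one_sub_inv_le_log_of_pos (by linarith))
    have : 1 - (1 + p * y)⁻¹ = p * y / (1 + p * y) := by
      field_simp
      ring
    rw [this]
    gcongr
    exact mul_le_of_le_one_left hy0 hp1
  have h3 : Real.exp (v * y * s) ≤ (1 - y) ^ v * (1 + p * y) ^ q := by
    calc Real.exp (v * y * s)
        ≤ Real.exp (v * -(y / (1 - y)) + q * (p * y / (1 + y))) := by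
          refine Real.exp_le_exp.2 ?_
          have e1 : (q : ℝ) * (p * y / (1 + y)) = p * q * (y / (1 + y)) := by ring
          have e2 : (1 + 2 * s) * v * (y / (1 + y)) ≤ p * q * (y / (1 + y)) :=
            mul_le_mul_of_nonneg_right hpv (by positivity)
          have e3 : s ≤ (1 + 2 * s) / (1 + y) - 1 / (1 - y) := by
            rw [div_sub_div _ _ (by linarith) (by linarith), le_div_iff₀ (by nlinarith)]
            nlinarith [mul_nonneg hs (mul_nonneg hy0 hy0)]
          have e4 := mul_le_mul_of_nonneg_left e3 (by positivity : 0 ≤ (v : ℝ) * y)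
          have e5 : (v : ℝ) * y * ((1 + 2 * s) / (1 + y) - 1 / (1 - y)) =
              v * -(y / (1 - y)) + (1 + 2 * s) * v * (y / (1 + y)) := by ring
          linarith
      _ = Real.exp (-(y / (1 - y))) ^ v * Real.exp (p * y / (1 + y)) ^ q := by
          rw [Real.exp_add, Real.exp_nat_mul, Real.exp_nat_mul]
      _ ≤ _ := by gcongr
  have h0 : 0 ≤ ∑ F : Finset (Clause n) with ¬ HasPath F L, wt p F :=
    sum_nonneg fun F _ => wt_nonneg hp0 hp1 F
  rw [Real.exp_neg, ← one_div, le_div_iff₀ (Real.exp_pos _)]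
  exact (mul_le_mul_of_nonneg_left h3 h0).trans h

lemma pr_sat_mul_le {m h v : ℕ} (hv : v ≤ n) {p₁ p₂ s y : ℝ} (h1 : 0 ≤ p₁) (h2 : 0 ≤ p₂)
    (h12 : p₁ + p₂ < 1) (hs : 0 ≤ s) (hy0 : 0 ≤ y) (hy1 : y < 1) (hsy : y * (2 + 2 * s) ≤ s)
    (hpv : (1 + 2 * s) * v ≤ p₁ * ((v - 4 * h : ℕ) * (2 * (n - v : ℕ)) : ℕ)) :
    pr {s : Finset (Clause n) // s.card = m} (fun F => Sat F.val) *
      (1 - Fintype.card (Clause n) * (p₁ + p₂) / (m + 1)) ≤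
      Real.exp (-(v * y * s)) + 2 * Real.exp (-(p₂ * h ^ 2)) := by
  classical
  rw [pr_eq]
  refine (density_mul_le (fun F G h hG => hG.mono h) (by linarith) h12.le m).trans ?_
  refine (sum_wt_two_round (G := fun F => HasPath F (4 * h)) h1 h2 h12
    fun F₁ hF => hF.disjoint_or).trans ?_
  refine add_le_add (sum_wt_not_hasPath_le_exp hv h1 (by linarith) hs hy0 hy1 hsy hpv) ?_
  have : 1 - p₂ ≤ Real.exp (-p₂) := by linarith [Real.add_one_le_exp (-p₂)]
  refine mul_le_mul_of_nonneg_left ?_ zero_le_two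
  refine (pow_le_pow_left₀ (by linarith) this _).trans (le_of_eq ?_)
  rw [← Real.exp_nat_mul]
  push_cast
  ring_nf

lemma tendsto_pr_sat_zero {δ : ℝ} (hδ : 1 < δ) :
    Tendsto (fun n : ℕ => pr {s : Finset (Clause n) // s.card = ⌊δ * n⌋₊}
      (fun F => Sat F.val)) atTop (nhds 0) := by
  obtain ⟨τ, hτ, hτδ⟩ : ∃ τ : ℝ, 0 < τ ∧ 1 + 2 * τ < δ :=
    ⟨(δ - 1) / 3, by linarith, by linarith⟩
  obtain ⟨K, hK⟩ := exists_nat_gt (4 * (1 + τ) / τ)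
  rw [div_lt_iff₀ hτ] at hK
  have hK1 : (1 : ℝ) ≤ K := by nlinarith
  have hKpos : 0 < K := by exact_mod_cast zero_lt_one.trans_le hK1
  have hKτ : (1 + τ / 2) * K ^ 2 ≤ (1 + τ) * (K - 1) ^ 2 := by
    nlinarith [mul_nonneg (zero_le_one.trans hK1) (sub_nonneg.2 hK.le)]
  set κ := 1 - (1 + 2 * τ) / δ with hκ
  have hκ0 : 0 < κ := by
    rw [hκ, sub_pos, div_lt_one (by linarith)]
    exact hτδ
  set s := τ / 4 with hs
  have hs0 : 0 < s := by positivity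
  set y := s / (2 + 2 * s) with hy
  have hsy : y * (2 + 2 * s) = s := div_mul_cancel₀ _ (by positivity)
  have hy0 : 0 < y := by positivity
  have hy1 : y < 1 := by nlinarith
  set h : ℕ → ℕ := fun n => n / (4 * K ^ 2) with hh
  have hlim : Tendsto (fun n => (h n : ℝ)) atTop atTop :=
    tendsto_natCast_atTop_atTop.comp (Nat.tendsto_div_const_atTop (by positivity))
  have hexp : ∀ c : ℝ, 0 < c → Tendsto (fun n => Real.exp (-(c * h n))) atTop (nhds 0) :=
    fun c hc => Real.tendsto_exp_neg_atTop_nhds_zero.comp (hlim.const_mul_atTop hc)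
  have hupper : ∀ᶠ n : ℕ in atTop,
      pr {s : Finset (Clause n) // s.card = ⌊δ * n⌋₊} (fun F => Sat F.val) ≤
      (Real.exp (-(4 * K * y * s * h n)) +
        2 * Real.exp (-(τ / (16 * K ^ 2) * h n))) / κ := by
    obtain ⟨n₀, hn₀⟩ := exists_nat_gt δ
    filter_upwards [eventually_ge_atTop (max n₀ (4 * K ^ 2))] with n hn
    have hnδ : δ < n := hn₀.trans_le (by exact_mod_cast (le_max_left _ _).trans hn)
    have hn0 : (0 : ℝ) < n := by linarith
    have hh1 : 1 ≤ h n := (Nat.one_le_div_iff (by positivity)).2 ((le_max_right _ _).trans hn)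
    have hle : h n * (4 * K ^ 2) ≤ n := Nat.div_mul_le_self _ _
    have hge : n ≤ 8 * K ^ 2 * h n := by
      have := Nat.lt_div_mul_add (a := n) (b := 4 * K ^ 2) (by positivity)
      change n < h n * (4 * K ^ 2) + 4 * K ^ 2 at this
      nlinarith
    have hvn : K * (4 * h n) ≤ n := by nlinarith
    have hle' : (h n : ℝ) * (4 * K ^ 2) ≤ n := by exact_mod_cast hle
    have hge' : (n : ℝ) ≤ 8 * K ^ 2 * h n := by exact_mod_cast hge
    have hh1' : (1 : ℝ) ≤ h n := by exact_mod_cast hh1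
    rw [le_div_iff₀ hκ0]
    have hmain := pr_sat_mul_le (m := ⌊δ * n⌋₊) (h := h n) hvn
      (p₁ := (1 + τ) / (2 * n)) (p₂ := τ / (2 * n)) (s := s) (y := y) (by positivity)
      (by positivity) ?_ hs0.le hy0.le hy1 hsy.le ?_
    · have e1 : κ ≤ 1 - Fintype.card (Clause n) * ((1 + τ) / (2 * n) + τ / (2 * n)) /
          (⌊δ * n⌋₊ + 1) := by
        refine sub_le_sub_left ?_ _
        have hfl : δ * n < ⌊δ * n⌋₊ + 1 := Nat.lt_floor_add_one _
        have hN : Fintype.card (Clause n) * ((1 + τ) / (2 * n) + τ / (2 * n)) =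
            (1 + 2 * τ) * (n - 1) := by
          rw [card_clause]
          field_simp
          ring
        rw [hN, div_le_div_iff₀ (by positivity) (by linarith)]
        nlinarith
      refine (mul_le_mul_of_nonneg_left e1 (pr_nonneg _ _)).trans (hmain.trans ?_)
      refine add_le_add (Real.exp_le_exp.2 (le_of_eq ?_))
        (mul_le_mul_of_nonneg_left (Real.exp_le_exp.2 (neg_le_neg ?_)) zero_le_two)
      · push_cast
        ring
      · rw [div_mul_eq_mul_div, div_mul_eq_mul_div, div_le_div_iff₀ (by positivity) (by positivity)]
        have : 0 ≤ τ * h n := by positivity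
        nlinarith
    · rw [← add_div, div_lt_one (by positivity)]
      linarith
    · have hvL : K * (4 * h n) - 4 * h n = (K - 1) * (4 * h n) := by
        rw [Nat.sub_mul, one_mul]
      rw [hvL]
      push_cast [Nat.cast_sub hvn, Nat.cast_sub hKpos]
      have e1 : (n : ℝ) * (K - 1) ≤ K * (n - K * (4 * h n)) := by nlinarith
      have e2 : (1 + τ) / (2 * n) * ((K - 1) * (4 * h n) * (2 * (n - K * (4 * h n)))) =
          (1 + τ) * (K - 1) * (4 * h n) * (K * (n - K * (4 * h n))) / (n * K) := by
        field_simp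
      rw [e2, le_div_iff₀ (by positivity)]
      have e3 : 0 ≤ (1 + τ) * (K - 1) * (4 * h n) :=
        mul_nonneg (mul_nonneg (by positivity) (sub_nonneg.2 hK1)) (by positivity)
      refine le_trans ?_ (mul_le_mul_of_nonneg_left e1 e3)
      have e4 := mul_le_mul_of_nonneg_right hKτ (by positivity : (0 : ℝ) ≤ 4 * h n * n)
      have e5 : 1 + 2 * s = 1 + τ / 2 := by rw [hs]; ring
      rw [e5]
      linarith
  refine squeeze_zero' (Eventually.of_forall fun n => pr_nonneg _ _) hupper ?_
  have := ((hexp (4 * K * y * s) (by positivity)).add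
    ((hexp (τ / (16 * K ^ 2)) (by positivity)).const_mul 2)).div_const κ
  simpa using this

end TwoSat

/-- Satisfiability threshold for random 2-CNF drawn from `𝓕₂(n, ⌊δn⌋)` (uniform over
sets of `⌊δn⌋` pairwise distinct 2-clauses): if `δ < 1` the probability of
satisfiability tends to `1`, if `δ > 1` it tends to `0`. -/
theorem sat_threshold_2CNF (δ : ℝ) (hδ : 0 ≤ δ) :
    (δ < 1 → Tendsto (fun n : ℕ =>
        pr {s : Finset (Clause n) // s.card = ⌊δ * n⌋₊}
          (fun F => ∃ σ : Fin n → Bool, ∀ C ∈ F.val, clauseSat σ C)) atTop (nhds 1)) ∧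
    (1 < δ → Tendsto (fun n : ℕ =>
        pr {s : Finset (Clause n) // s.card = ⌊δ * n⌋₊}
          (fun F => ∃ σ : Fin n → Bool, ∀ C ∈ F.val, clauseSat σ C)) atTop (nhds 0)) :=
  ⟨TwoSat.tendsto_pr_sat hδ, TwoSat.tendsto_pr_sat_zero⟩
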